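/- Let α > 1 and σ > 0 be real numbers, let ψ : ℝ → ℂ be a Schwartz function and let g : 𝕋 → ℂ be a smooth function. Let (a_n)_{n∈ℤ} be a square-summable family of complex numbers. For N ∈ ℕ define the smooth function F_N(t,x) = | Σ_{n ∈ ℤ, |n| ≤ N} ⟨n⟩^σ a_n e^{it|n|^α} e^{inx} |² − Σ_{n ∈ ℤ, |n| ≤ N} ⟨n⟩^{2σ} |a_n|². Then the sequence I_N = ∫_ℝ ∫_𝕋 ψ(t) g(x) F_N(t,x) dx dt converges in ℂ as N → ∞. -/

import Mathlib

open MeasureTheory Real AddCircle Filter Finset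

noncomputable section

instance : Fact ((0:ℝ) < 2 * π) := ⟨by positivity⟩

/-- The Japanese bracket `⟨x⟩ = (1 + x²)^{1/2}`. -/
def jb (x : ℝ) : ℝ := (1 + x ^ 2) ^ ((1:ℝ)/2)

lemma coeffOn_decay (j : ℕ) : ∀ f : ℝ → ℂ, ContDiff ℝ (⊤ : ℕ∞) f → Function.Periodic f (2 * π) →
    ∃ C : ℝ, 0 ≤ C ∧ ∀ n : ℤ, n ≠ 0 →
      |(n : ℝ)| ^ j * ‖fourierCoeffOn (lt_add_of_pos_right (0:ℝ) two_pi_pos) f n‖ ≤ C := by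
  induction j with
  | zero =>
    intro f hf hp
    refine ⟨|1 / (0 + 2 * π - 0)| * ∫ x in (0:ℝ)..(0 + 2 * π), ‖f x‖, ?_, fun n hn => ?_⟩
    · apply mul_nonneg (abs_nonneg _)
      exact intervalIntegral.integral_nonneg (by positivity) fun _ _ => norm_nonneg _
    · rw [fourierCoeffOn_eq_integral, norm_smul, pow_zero, one_mul, Real.norm_eq_abs]
      gcongr
      refine (intervalIntegral.norm_integral_le_integral_norm (by positivity)).trans ?_
      apply le_of_eq
      congr 1
      ext x
      rw [norm_smul, fourier_apply, Circle.norm_coe, one_mul]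
  | succ j ih =>
    intro f hf hp
    have hd : ContDiff ℝ (⊤ : ℕ∞) (deriv f) := by
      exact ((contDiff_infty_iff_deriv (f := f)).1 hf).2
    have hp' : Function.Periodic (deriv f) (2 * π) := by
      intro x
      have : (fun y => f (y + 2 * π)) = f := funext hp
      rw [← deriv_comp_add_const, this]
    obtain ⟨C, hC, h⟩ := ih _ hd hp'
    refine ⟨C, hC, fun n hn => ?_⟩
    have hdiff : Differentiable ℝ f := hf.differentiable (by simp)
    rw [fourierCoeffOn_of_hasDerivAt (f' := deriv f) _ hn (fun x _ => (hdiff x).hasDerivAt)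
      (hd.continuous.intervalIntegrable _ _), hp 0, sub_self, mul_zero, zero_sub]
    have hn' : (0:ℝ) < |(n : ℝ)| := by positivity
    have e : ‖(1 / (-2 * (π:ℂ) * Complex.I * n) *
        -((((0 + 2 * π : ℝ) : ℂ) - ((0:ℝ):ℂ)) * fourierCoeffOn
          (lt_add_of_pos_right (0:ℝ) two_pi_pos) (deriv f) n))‖ =
        |(n : ℝ)|⁻¹ * ‖fourierCoeffOn (lt_add_of_pos_right (0:ℝ) two_pi_pos) (deriv f) n‖ := by
      simp [abs_of_pos pi_pos]
      field_simp
    rw [e]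
    calc _ = |(n : ℝ)| ^ j *
        ‖fourierCoeffOn (lt_add_of_pos_right (0:ℝ) two_pi_pos) (deriv f) n‖ := by
          rw [pow_succ, mul_assoc, mul_inv_cancel_left₀ hn'.ne']
      _ ≤ C := h n hn

lemma coeff_decay (g : AddCircle (2 * π) → ℂ)
    (hg : ContDiff ℝ (⊤ : ℕ∞) (fun x : ℝ => g (x : AddCircle (2 * π)))) (j : ℕ) :
    ∃ C : ℝ, 0 ≤ C ∧ ∀ n : ℤ, n ≠ 0 → |(n : ℝ)| ^ j * ‖fourierCoeff g n‖ ≤ C := by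
  obtain ⟨C, hC, h⟩ := coeffOn_decay j _ hg (fun x => by simp)
  refine ⟨C, hC, fun n hn => ?_⟩
  have e : AddCircle.liftIoc (2 * π) 0 (fun x : ℝ => g (x : AddCircle (2 * π))) = g := by
    ext z
    obtain ⟨x, hx, rfl⟩ : z ∈ ((↑) : ℝ → AddCircle (2 * π)) '' Set.Ioc (0:ℝ) (0 + 2 * π) := by
      rw [AddCircle.coe_image_Ioc_eq]; trivial
    rw [AddCircle.liftIoc_coe_apply hx]
  have := h n hn
  rw [← fourierCoeff_liftIoc_eq, e] at this
  exact this

/-- Oscillatory integral of the time test function. -/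
def osc (ψ : SchwartzMap ℝ ℂ) (ξ : ℝ) : ℂ := ∫ t : ℝ, ψ t * Complex.exp (Complex.I * t * ξ)

open scoped FourierTransform in
lemma osc_eq (ψ : SchwartzMap ℝ ℂ) (ξ : ℝ) : osc ψ ξ = (𝓕 ψ) (-(ξ / (2 * π))) := by
  rw [SchwartzMap.fourier_coe, Real.fourier_real_eq_integral_exp_smul, osc]
  congr 1
  ext t
  rw [smul_eq_mul, mul_comm]
  congr 2
  push_cast
  have : (π : ℂ) ≠ 0 := by exact_mod_cast pi_ne_zero
  field_simp

open scoped FourierTransform in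
lemma osc_decay (ψ : SchwartzMap ℝ ℂ) (k : ℕ) :
    ∃ C : ℝ, 0 ≤ C ∧ ∀ ξ : ℝ, |ξ| ^ k * ‖osc ψ ξ‖ ≤ C := by
  obtain ⟨C, hC, h⟩ := (𝓕 ψ).decay k 0
  refine ⟨(2 * π) ^ k * C, by positivity, fun ξ => ?_⟩
  have := h (-(ξ / (2 * π)))
  rw [norm_iteratedFDeriv_zero, ← osc_eq, norm_neg, norm_div, div_pow, Real.norm_eq_abs,
    Real.norm_eq_abs, abs_of_pos two_pi_pos] at this
  calc |ξ| ^ k * ‖osc ψ ξ‖ = (2 * π) ^ k * (|ξ| ^ k / (2 * π) ^ k * ‖osc ψ ξ‖) := by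
        field_simp
    _ ≤ _ := by gcongr

lemma osc_integrable (ψ : SchwartzMap ℝ ℂ) (ξ : ℝ) :
    Integrable (fun t : ℝ => ψ t * Complex.exp (Complex.I * t * ξ)) := by
  refine (ψ.integrable (μ := volume)).mul_bdd (c := 1) (by fun_prop) (ae_of_all _ fun t => ?_)
  have : Complex.I * t * ξ = ((t * ξ : ℝ) : ℂ) * Complex.I := by push_cast; ring
  rw [this, Complex.norm_exp_ofReal_mul_I]

lemma jb_pos (x : ℝ) : 0 < jb x := by unfold jb; positivity

lemma jb_le (x : ℝ) : jb x ≤ 1 + |x| := by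
  unfold jb
  rw [← Real.sqrt_eq_rpow]
  apply Real.sqrt_le_iff.2
  refine ⟨by positivity, ?_⟩
  nlinarith [abs_nonneg x, sq_abs x]

lemma gap_aux {α p q : ℝ} (hα : 1 < α) (hq : 0 ≤ q) (hpq : q + 1 ≤ p) :
    p ^ (α - 1) ≤ p ^ α - q ^ α := by
  have hp : 0 < p := by linarith
  have e1 : p ^ α = p ^ (α - 1) * p := by
    rw [← Real.rpow_add_one hp.ne']; congr 1; ring
  have e2 : q ^ α ≤ p ^ (α - 1) * q := by
    rcases hq.eq_or_lt with rfl | hq'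
    · rw [Real.zero_rpow (by linarith)]; simp
    · have : q ^ α = q ^ (α - 1) * q := by
        rw [← Real.rpow_add_one hq'.ne']; congr 1; ring
      rw [this]
      gcongr
      linarith
  have : 0 < p ^ (α - 1) := by positivity
  nlinarith

lemma gap {α : ℝ} (hα : 1 < α) (n m : ℤ) (h : |n| ≠ |m|) :
    (max |(n:ℝ)| |(m:ℝ)|) ^ (α - 1) ≤ |(|(n:ℝ)| ^ α - |(m:ℝ)| ^ α)| := by
  rcases lt_or_gt_of_ne h with h | h
  · have h' : |(n:ℝ)| + 1 ≤ |(m:ℝ)| := by exact_mod_cast h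
    rw [max_eq_right (by linarith), abs_sub_comm]
    exact (gap_aux hα (abs_nonneg _) h').trans (le_abs_self _)
  · have h' : |(m:ℝ)| + 1 ≤ |(n:ℝ)| := by exact_mod_cast h
    rw [max_eq_left (by linarith)]
    exact (gap_aux hα (abs_nonneg _) h').trans (le_abs_self _)

lemma kernel_bound (α σ : ℝ) (hα : 1 < α) (hσ : 0 < σ) (ψ : SchwartzMap ℝ ℂ)
    (g : AddCircle (2 * π) → ℂ)
    (hg : ContDiff ℝ (⊤ : ℕ∞) (fun x : ℝ => g (x : AddCircle (2 * π)))) :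
    ∃ C : ℝ, 0 ≤ C ∧ ∀ n m : ℤ, n ≠ m →
      jb n ^ σ * jb m ^ σ * ‖osc ψ (|(n:ℝ)| ^ α - |(m:ℝ)| ^ α)‖ * ‖fourierCoeff g (m - n)‖
        ≤ C * (1 / ((m - n : ℤ) : ℝ) ^ 2) := by
  obtain ⟨j, hj⟩ := exists_nat_ge (2 * σ)
  obtain ⟨k, hk⟩ := exists_nat_ge (2 * σ / (α - 1))
  rw [div_le_iff₀ (by linarith)] at hk
  obtain ⟨P0, hP0, hP⟩ := osc_decay ψ 0
  obtain ⟨Q0, hQ0, hQ⟩ := osc_decay ψ k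
  obtain ⟨G0, hG0, hG⟩ := coeff_decay g hg (j + 2)
  obtain ⟨H0, hH0, hH⟩ := coeff_decay g hg 2
  refine ⟨P0 * G0 + 2 ^ (2 * σ) * Q0 * H0, by positivity, fun n m hnm => ?_⟩
  have hd : m - n ≠ 0 := sub_ne_zero.2 hnm.symm
  have hdpos : 0 < |((m - n : ℤ) : ℝ)| := by positivity
  have hjn := jb_pos n
  have hjm := jb_pos m
  rw [mul_one_div, le_div_iff₀ (by positivity)]
  rw [← sq_abs]
  set d : ℝ := |((m - n : ℤ) : ℝ)| with hddef
  by_cases h : |n| = |m|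
  · have hm : m = -n := by
      rcases abs_eq_abs.1 h with h | h
      · exact absurd h hnm
      · omega
    have hn0 : n ≠ 0 := by rintro rfl; exact hnm (by simp [hm])
    have hn1 : 1 ≤ |(n:ℝ)| := by exact_mod_cast Int.one_le_abs hn0
    have hde : d = 2 * |(n:ℝ)| := by
      rw [hddef, hm]; push_cast
      rw [show (-(n:ℝ) - n) = (-2) * n by ring, abs_mul]; norm_num
    have hd1 : 1 ≤ d := by linarith
    have b1 : jb n ≤ d := (jb_le n).trans (by linarith)
    have b2 : jb m ≤ d := (jb_le m).trans (by rw [hm]; push_cast; rw [abs_neg]; linarith)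
    have w : jb n ^ σ * jb m ^ σ ≤ d ^ j := by
      calc jb n ^ σ * jb m ^ σ ≤ d ^ σ * d ^ σ := by gcongr
        _ = d ^ (2 * σ) := by rw [← Real.rpow_add hdpos]; congr 1; ring
        _ ≤ d ^ (j : ℝ) := Real.rpow_le_rpow_of_exponent_le hd1 hj
        _ = d ^ j := Real.rpow_natCast _ _
    have p := hP (|(n:ℝ)| ^ α - |(m:ℝ)| ^ α)
    rw [pow_zero, one_mul] at p
    have q := hG _ hd
    calc jb n ^ σ * jb m ^ σ * ‖osc ψ (|(n:ℝ)| ^ α - |(m:ℝ)| ^ α)‖ * ‖fourierCoeff g (m - n)‖ * d ^ 2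
        ≤ d ^ j * P0 * ‖fourierCoeff g (m - n)‖ * d ^ 2 := by gcongr
      _ = P0 * (d ^ (j + 2) * ‖fourierCoeff g (m - n)‖) := by ring
      _ ≤ P0 * G0 := by gcongr
      _ ≤ _ := by
        have : 0 ≤ 2 ^ (2 * σ) * Q0 * H0 := by positivity
        linarith
  · have gp := gap hα n m h
    set M : ℝ := max |(n:ℝ)| |(m:ℝ)| with hM
    have hM1 : 1 ≤ M := by
      rcases eq_or_ne n 0 with rfl | hn0
      · have : m ≠ 0 := fun hm => hnm hm.symm
        exact le_max_of_le_right (by exact_mod_cast Int.one_le_abs this)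
      · exact le_max_of_le_left (by exact_mod_cast Int.one_le_abs hn0)
    have hM0 : 0 < M := by linarith
    have b1 : jb n ≤ 2 * M := (jb_le n).trans (by linarith [le_max_left |(n:ℝ)| |(m:ℝ)|])
    have b2 : jb m ≤ 2 * M := (jb_le m).trans (by linarith [le_max_right |(n:ℝ)| |(m:ℝ)|])
    have w : jb n ^ σ * jb m ^ σ ≤ 2 ^ (2 * σ) * |(|(n:ℝ)| ^ α - |(m:ℝ)| ^ α)| ^ k := by
      calc jb n ^ σ * jb m ^ σ ≤ (2 * M) ^ σ * (2 * M) ^ σ := by gcongr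
        _ = (2 * M) ^ (2 * σ) := by rw [← Real.rpow_add (by positivity)]; congr 1; ring
        _ = 2 ^ (2 * σ) * M ^ (2 * σ) := Real.mul_rpow (by norm_num) hM0.le
        _ ≤ 2 ^ (2 * σ) * M ^ ((α - 1) * k) := by
          apply mul_le_mul_of_nonneg_left _ (by positivity)
          exact Real.rpow_le_rpow_of_exponent_le hM1 (by linarith)
        _ = 2 ^ (2 * σ) * (M ^ (α - 1)) ^ k := by rw [Real.rpow_mul hM0.le, Real.rpow_natCast]
        _ ≤ _ := by gcongr
    have p := hQ (|(n:ℝ)| ^ α - |(m:ℝ)| ^ α)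
    have q := hH _ hd
    set X := |(n:ℝ)| ^ α - |(m:ℝ)| ^ α
    calc jb n ^ σ * jb m ^ σ * ‖osc ψ X‖ * ‖fourierCoeff g (m - n)‖ * d ^ 2
        ≤ 2 ^ (2 * σ) * |X| ^ k * ‖osc ψ X‖ * ‖fourierCoeff g (m - n)‖ * d ^ 2 := by gcongr
      _ = 2 ^ (2 * σ) * (|X| ^ k * ‖osc ψ X‖) * (d ^ 2 * ‖fourierCoeff g (m - n)‖) := by ring
      _ ≤ 2 ^ (2 * σ) * Q0 * H0 := by gcongr
      _ ≤ _ := by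
        have : 0 ≤ P0 * G0 := by positivity
        linarith

/-- The off-diagonal terms. -/
def term (α σ : ℝ) (ψ : SchwartzMap ℝ ℂ) (g : AddCircle (2 * π) → ℂ) (a : ℤ → ℂ)
    (p : ℤ × ℤ) : ℂ :=
  ((jb p.1 ^ σ : ℝ) : ℂ) * a p.1 * (((jb p.2 ^ σ : ℝ) : ℂ) * starRingEnd ℂ (a p.2)) *
    osc ψ (|(p.1:ℝ)| ^ α - |(p.2:ℝ)| ^ α) * fourierCoeff g (p.2 - p.1)

lemma summable_aux (b : ℤ → ℝ) (hb : Summable b) (hb0 : ∀ n, 0 ≤ b n) :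
    Summable (fun p : ℤ × ℤ => b p.1 * (1 / ((p.2 - p.1 : ℤ) : ℝ) ^ 2)) := by
  have h := hb.mul_of_nonneg (Real.summable_one_div_int_pow.2 one_lt_two) hb0
    (fun n => by positivity)
  exact (Equiv.summable_iff (Equiv.prodShear (Equiv.refl ℤ) (fun n => Equiv.subRight n))).2 h

lemma summable_term (α σ : ℝ) (hα : 1 < α) (hσ : 0 < σ) (ψ : SchwartzMap ℝ ℂ)
    (g : AddCircle (2 * π) → ℂ)
    (hg : ContDiff ℝ (⊤ : ℕ∞) (fun x : ℝ => g (x : AddCircle (2 * π))))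
    (a : ℤ → ℂ) (ha : Summable (fun n => ‖a n‖ ^ 2)) :
    Summable (fun p : ℤ × ℤ => if p.1 = p.2 then 0 else term α σ ψ g a p) := by
  obtain ⟨C, hC, h⟩ := kernel_bound α σ hα hσ ψ g hg
  have s1 := summable_aux _ ha (fun n => by positivity)
  have s2 : Summable (fun p : ℤ × ℤ => ‖a p.2‖ ^ 2 * (1 / ((p.2 - p.1 : ℤ) : ℝ) ^ 2)) := by
    refine ((Equiv.prodComm ℤ ℤ).summable_iff.2 s1).congr fun p => ?_
    simp only [Function.comp, Equiv.prodComm_apply, Prod.fst_swap, Prod.snd_swap]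
    push_cast
    rw [← neg_sub, neg_sq]
  refine Summable.of_norm_bounded ((s1.add s2).mul_left C) fun p => ?_
  obtain ⟨n, m⟩ := p
  dsimp only
  split_ifs with hnm
  · rw [norm_zero]; positivity
  · have k := h n m hnm
    have hjn := jb_pos n
    have hjm := jb_pos m
    have e : ‖term α σ ψ g a (n, m)‖ = (‖a n‖ * ‖a m‖) *
        (jb n ^ σ * jb m ^ σ * ‖osc ψ (|(n:ℝ)| ^ α - |(m:ℝ)| ^ α)‖ * ‖fourierCoeff g (m - n)‖) := by
      have h1 : ‖((jb n ^ σ : ℝ) : ℂ)‖ = jb n ^ σ := by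
        rw [Complex.norm_real, Real.norm_of_nonneg (by positivity)]
      have h2 : ‖((jb m ^ σ : ℝ) : ℂ)‖ = jb m ^ σ := by
        rw [Complex.norm_real, Real.norm_of_nonneg (by positivity)]
      simp only [term, norm_mul, h1, h2, RCLike.norm_conj]
      ring
    rw [e]
    calc _ ≤ (‖a n‖ ^ 2 + ‖a m‖ ^ 2) * (C * (1 / ((m - n : ℤ) : ℝ) ^ 2)) := by
          gcongr
          nlinarith [sq_nonneg (‖a n‖ - ‖a m‖), sq_nonneg (‖a n‖), sq_nonneg (‖a m‖)]
      _ = _ := by ring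

lemma square_expand (S : Finset ℤ) (z : ℤ → ℂ) :
    ((‖∑ n ∈ S, z n‖ ^ 2 : ℝ) : ℂ) - ∑ n ∈ S, ((‖z n‖ ^ 2 : ℝ) : ℂ) =
      ∑ p ∈ S.offDiag, z p.1 * starRingEnd ℂ (z p.2) := by
  have key : ∀ w : ℂ, ((‖w‖ ^ 2 : ℝ) : ℂ) = w * starRingEnd ℂ w := fun w => by
    rw [Complex.mul_conj, Complex.normSq_eq_norm_sq]
  simp only [key]
  rw [map_sum, Finset.sum_mul_sum, ← Finset.sum_product', ← Finset.diag_union_offDiag,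
    Finset.sum_union (Finset.disjoint_diag_offDiag _), Finset.sum_diag]
  ring

lemma pointwise (α σ : ℝ) (a : ℤ → ℂ) (S : Finset ℤ) (t : ℝ) (x : AddCircle (2 * π)) :
    ((‖∑ n ∈ S, ((jb ((n : ℤ) : ℝ) ^ σ : ℝ) : ℂ) * a n
                    * Complex.exp (Complex.I * t * ((|((n : ℤ) : ℝ)| ^ α : ℝ) : ℂ))
                    * fourier n x‖ ^ 2
              - ∑ n ∈ S, jb ((n : ℤ) : ℝ) ^ (2 * σ) * ‖a n‖ ^ 2 : ℝ) : ℂ) =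
    ∑ p ∈ S.offDiag, ((jb p.1 ^ σ : ℝ) : ℂ) * a p.1 *
      (((jb p.2 ^ σ : ℝ) : ℂ) * starRingEnd ℂ (a p.2)) *
      Complex.exp (Complex.I * t * ((|(p.1:ℝ)| ^ α - |(p.2:ℝ)| ^ α : ℝ) : ℂ)) *
      fourier (p.1 - p.2) x := by
  have ex : ∀ r : ℝ, Complex.I * t * r = ((t * r : ℝ) : ℂ) * Complex.I := fun r => by
    push_cast; ring
  have hz : ∀ n ∈ S, jb ((n : ℤ) : ℝ) ^ (2 * σ) * ‖a n‖ ^ 2 =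
      ‖((jb ((n : ℤ) : ℝ) ^ σ : ℝ) : ℂ) * a n
        * Complex.exp (Complex.I * t * ((|((n : ℤ) : ℝ)| ^ α : ℝ) : ℂ)) * fourier n x‖ ^ 2 := by
    intro n _
    have := jb_pos n
    rw [norm_mul, norm_mul, norm_mul, ex, Complex.norm_exp_ofReal_mul_I, fourier_apply,
      Circle.norm_coe, Complex.norm_real, Real.norm_of_nonneg (by positivity), mul_one, mul_one,
      mul_pow, ← Real.rpow_natCast (jb n ^ σ), ← Real.rpow_mul this.le]
    congr 2
    push_cast; ring
  rw [Finset.sum_congr rfl hz, Complex.ofReal_sub, Complex.ofReal_sum, square_expand]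
  refine Finset.sum_congr rfl fun p _ => ?_
  rw [map_mul, map_mul, map_mul, Complex.conj_ofReal, ← Complex.exp_conj, ← fourier_neg,
    sub_eq_add_neg p.1, fourier_add, Complex.ofReal_sub, mul_sub, sub_eq_add_neg (Complex.I * _ * _),
    Complex.exp_add]
  have : starRingEnd ℂ (Complex.I * t * ((|((p.2 : ℤ) : ℝ)| ^ α : ℝ) : ℂ)) =
      -(Complex.I * t * ((|((p.2 : ℤ) : ℝ)| ^ α : ℝ) : ℂ)) := by
    rw [map_mul, map_mul, Complex.conj_ofReal, Complex.conj_ofReal, Complex.conj_I]; ring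
  rw [this]
  ring

lemma integral_eq (α σ : ℝ) (ψ : SchwartzMap ℝ ℂ)
    (g : AddCircle (2 * π) → ℂ) (hg : Continuous g) (a : ℤ → ℂ) (S : Finset ℤ) :
    (∫ t : ℝ, ∫ x : AddCircle (2 * π),
          ψ t * g x *
            ((‖∑ n ∈ S, ((jb ((n : ℤ) : ℝ) ^ σ : ℝ) : ℂ) * a n
                    * Complex.exp (Complex.I * t * ((|((n : ℤ) : ℝ)| ^ α : ℝ) : ℂ))
                    * fourier n x‖ ^ 2
              - ∑ n ∈ S, jb ((n : ℤ) : ℝ) ^ (2 * σ) * ‖a n‖ ^ 2 : ℝ) : ℂ)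
          ∂haarAddCircle) = ∑ p ∈ S.offDiag, term α σ ψ g a p := by
  have inner : ∀ t : ℝ, (∫ x : AddCircle (2 * π),
          ψ t * g x *
            ((‖∑ n ∈ S, ((jb ((n : ℤ) : ℝ) ^ σ : ℝ) : ℂ) * a n
                    * Complex.exp (Complex.I * t * ((|((n : ℤ) : ℝ)| ^ α : ℝ) : ℂ))
                    * fourier n x‖ ^ 2
              - ∑ n ∈ S, jb ((n : ℤ) : ℝ) ^ (2 * σ) * ‖a n‖ ^ 2 : ℝ) : ℂ)
          ∂haarAddCircle) = ∑ p ∈ S.offDiag,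
        (((jb p.1 ^ σ : ℝ) : ℂ) * a p.1 * (((jb p.2 ^ σ : ℝ) : ℂ) * starRingEnd ℂ (a p.2)) *
          fourierCoeff g (p.2 - p.1)) *
        (ψ t * Complex.exp (Complex.I * t * ((|(p.1:ℝ)| ^ α - |(p.2:ℝ)| ^ α : ℝ) : ℂ))) := by
    intro t
    simp only [pointwise, Finset.mul_sum]
    rw [integral_finsetSum]
    · refine Finset.sum_congr rfl fun p _ => ?_
      rw [fourierCoeff, neg_sub]
      simp only [smul_eq_mul]
      refine Eq.trans ?_ (Eq.trans (integral_const_mul (μ := haarAddCircle)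
        (((jb p.1 ^ σ : ℝ) : ℂ) * a p.1 * (((jb p.2 ^ σ : ℝ) : ℂ) * starRingEnd ℂ (a p.2)) *
        (ψ t * Complex.exp (Complex.I * t * ((|(p.1:ℝ)| ^ α - |(p.2:ℝ)| ^ α : ℝ) : ℂ))))
        (fun x : AddCircle (2 * π) => fourier (p.1 - p.2) x * g x)) ?_)
      · refine integral_congr_ae (ae_of_all _ fun x => ?_)
        simp only
        ring
      · ring
    · intro p _
      apply Continuous.integrable_of_hasCompactSupport
      · fun_prop
      · exact HasCompactSupport.of_compactSpace _
  simp only [inner]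
  rw [integral_finsetSum]
  · refine Finset.sum_congr rfl fun p _ => ?_
    rw [integral_const_mul, term, osc]
    ring
  · intro p _
    exact (osc_integrable ψ _).const_mul _

/-- Renormalized smoothing effect tested against tensorized test functions:
for a Schwartz function `ψ` in time and a smooth function `g` on the circle,
the integrals `I_N = ∫∫ ψ(t) g(x) F_N(t,x) dx dt` of the renormalized squares
`F_N = |⟨D_x⟩^σ e^{it|D_x|^α} Π_N u₀|² − ‖Π_N u₀‖²_{H^σ}` converge. -/
theorem renormalized_square_converges_distributionally
    (α σ : ℝ) (hα : 1 < α) (hσ : 0 < σ)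
    (ψ : SchwartzMap ℝ ℂ)
    (g : AddCircle (2 * π) → ℂ)
    (hg : ContDiff ℝ (⊤ : ℕ∞) (fun x : ℝ => g (x : AddCircle (2 * π))))
    (a : ℤ → ℂ) (ha : Summable (fun n => ‖a n‖ ^ 2)) :
    ∃ L : ℂ, Tendsto
      (fun N : ℕ =>
        ∫ t : ℝ, ∫ x : AddCircle (2 * π),
          ψ t * g x *
            ((‖∑ n ∈ Finset.Icc (-(N : ℤ)) (N : ℤ),
                  ((jb ((n : ℤ) : ℝ) ^ σ : ℝ) : ℂ) * a n
                    * Complex.exp (Complex.I * t * ((|((n : ℤ) : ℝ)| ^ α : ℝ) : ℂ))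
                    * fourier n x‖ ^ 2
              - ∑ n ∈ Finset.Icc (-(N : ℤ)) (N : ℤ),
                  jb ((n : ℤ) : ℝ) ^ (2 * σ) * ‖a n‖ ^ 2 : ℝ) : ℂ)
          ∂haarAddCircle)
      atTop (nhds L) := by
  have hgc : Continuous g := by
    refine (QuotientAddGroup.isQuotientMap_mk (N := AddSubgroup.zmultiples (2 * π))).continuous_iff.2 ?_
    exact hg.continuous
  have hs := summable_term α σ hα hσ ψ g hg a ha
  refine ⟨∑' p : ℤ × ℤ, if p.1 = p.2 then 0 else term α σ ψ g a p, ?_⟩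
  have hS : Tendsto (fun N : ℕ => (Finset.Icc (-(N : ℤ)) (N : ℤ)) ×ˢ (Finset.Icc (-(N : ℤ)) (N : ℤ)))
      atTop atTop := by
    apply tendsto_atTop_finset_of_monotone
    · intro N M h
      have h' : (N : ℤ) ≤ M := by exact_mod_cast h
      have := Finset.Icc_subset_Icc (neg_le_neg h') h'
      exact Finset.product_subset_product this this
    · rintro ⟨n, m⟩
      refine ⟨n.natAbs + m.natAbs, ?_⟩
      simp only [Finset.mem_product, Finset.mem_Icc]
      omega
  refine (hs.hasSum.comp hS).congr fun N => ?_
  rw [integral_eq α σ ψ g hgc a]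
  simp only [Function.comp]
  rw [← Finset.diag_union_offDiag, Finset.sum_union (Finset.disjoint_diag_offDiag _),
    Finset.sum_diag]
  simp only [if_true, Finset.sum_const_zero, zero_add]
  refine Finset.sum_congr rfl fun p hp => ?_
  rw [if_neg (Finset.mem_offDiag.1 hp).2.2]
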